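/- Fix λ > 1 and β > 0, and consider f_{β,λ}(z) = E_{g~N(0,1)}[tanh(β·g·√q_{β,βλz} + βλ·z)]. Then: (i) if h > 0 and (β, βλh) satisfies the AT condition, then the function m ↦ f_{β,λ}(m)/m is strictly decreasing at h, i.e., the derivative of h ↦ f_{β,λ}(h)/h at h is strictly negative; (ii) if (β, βλh) satisfies the AT condition, then f_{β,λ} is differentiable at h with f'_{β,λ}(h) ≥ 0; (iii) if β < 1, then f_{β,λ} is differentiable at 0 with f'_{β,λ}(0) = βλ; in particular, 0 is a stable fixed point of f_{β,λ} when βλ < 1 and an unstable fixed point when βλ > 1. -/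

import Mathlib

open MeasureTheory ProbabilityTheory

noncomputable section

/-- Standard Gaussian measure on `ℝ`. -/
def stdGaussian : Measure ℝ := gaussianReal 0 1

/-- The overlap constant `q_{β,h}`, the unique solution in `(0,1]` of the replica-symmetric
fixed point equation (set to `0` for `h = 0`). -/
def qOverlap (β h : ℝ) : ℝ :=
  if h = 0 then 0 else
    sSup {q : ℝ | q ∈ Set.Ioc (0 : ℝ) 1 ∧
      q = ∫ g, Real.tanh (β * g * Real.sqrt q + h) ^ 2 ∂stdGaussian}

/-- `q₁(β,h) = E tanh(β g √q_{β,h} + h)`. -/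
def q1 (β h : ℝ) : ℝ :=
  ∫ g, Real.tanh (β * g * Real.sqrt (qOverlap β h) + h) ∂stdGaussian

/-- Hyperbolic secant. -/
def sech (x : ℝ) : ℝ := 1 / Real.cosh x

/-- The Almeida–Thouless condition for `(β,h)`. -/
def ATCond (β h : ℝ) : Prop :=
  β ^ 2 * ∫ g, sech (β * g * Real.sqrt (qOverlap β h) + h) ^ 4 ∂stdGaussian < 1

/-- The AT condition with gap at least `g0`. -/
def ATgap (β h g0 : ℝ) : Prop :=
  β ^ 2 * ∫ g, sech (β * g * Real.sqrt (qOverlap β h) + h) ^ 4 ∂stdGaussian ≤ 1 - g0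

/-- The one-dimensional RGD/AMP update map `f_{β,λ}`. -/
def fbl (β lam z : ℝ) : ℝ :=
  ∫ g, Real.tanh (β * g * Real.sqrt (qOverlap β (β * lam * z)) + β * lam * z) ∂stdGaussian

/-- `h_* = inf{h ≥ 0 : (β,h) satisfies AT}`. -/
def hStar (β : ℝ) : ℝ := sInf {h : ℝ | 0 ≤ h ∧ ATCond β h}

open Filter Topology Set

/-- Standard Gaussian, as an abbreviation. -/
abbrev gam : Measure ℝ := gaussianReal 0 1

theorem hasDerivAt_tanh' (x : ℝ) : HasDerivAt Real.tanh (1 - Real.tanh x ^ 2) x := by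
  have h := (Real.hasDerivAt_sinh x).div (Real.hasDerivAt_cosh x) (Real.cosh_pos x).ne'
  have e : (Real.sinh / Real.cosh) = Real.tanh := by
    funext y; simp [Real.tanh_eq_sinh_div_cosh]
  rw [e] at h
  refine h.congr_deriv ?_
  rw [Real.tanh_eq_sinh_div_cosh]
  have := (Real.cosh_pos x).ne'
  field_simp

@[fun_prop]
theorem continuous_tanh' : Continuous Real.tanh :=
  continuous_iff_continuousAt.2 fun x => (hasDerivAt_tanh' x).continuousAt

theorem sech_sq (x : ℝ) : sech x ^ 4 = (1 - Real.tanh x ^ 2) ^ 2 := by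
  have := (Real.cosh_pos x).ne'
  have e : 1 - Real.tanh x ^ 2 = 1 / Real.cosh x ^ 2 := by
    rw [Real.tanh_eq_sinh_div_cosh]
    field_simp
    linarith [Real.cosh_sq x]
  rw [e, sech]
  field_simp

theorem tsq_le (x : ℝ) : Real.tanh x ^ 2 ≤ 1 := (Real.tanh_sq_lt_one x).le

theorem tanh_pos' {x : ℝ} (hx : 0 < x) : 0 < Real.tanh x := by
  rw [Real.tanh_eq_sinh_div_cosh]
  exact div_pos (Real.sinh_pos_iff.2 hx) (Real.cosh_pos x)

theorem integrable_bdd {f : ℝ → ℝ} (hf : Continuous f) {C : ℝ} (hC : ∀ x, |f x| ≤ C) :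
    Integrable f gam :=
  Integrable.of_bound hf.aestronglyMeasurable C (ae_of_all _ fun x => by simpa using hC x)

theorem integrable_id_gam : Integrable (fun g : ℝ => g) gam := by
  have := (memLp_id_gaussianReal (μ := 0) (v := 1) 1).integrable (by simp)
  exact this

theorem integrable_sq_gam : Integrable (fun g : ℝ => g ^ 2) gam := by
  have := (memLp_id_gaussianReal (μ := 0) (v := 1) 2).integrable_sq
  exact this

theorem integral_id_gam : ∫ g, g ∂gam = 0 := integral_id_gaussianReal

theorem integral_sq_gam : ∫ g, g ^ 2 ∂gam = 1 := by
  have h := variance_fun_id_gaussianReal (μ := 0) (v := 1)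
  rw [variance_eq_integral (by fun_prop)] at h
  simpa [integral_id_gaussianReal] using h

theorem integrable_mul_bdd {f : ℝ → ℝ} (hf : Continuous f) {C : ℝ} (hC : ∀ x, |f x| ≤ C) :
    Integrable (fun g => g * f g) gam := by
  refine Integrable.mono' (integrable_id_gam.abs.mul_const C) (by fun_prop) (ae_of_all _ fun x => ?_)
  simp only [Real.norm_eq_abs, abs_mul]
  gcongr
  exact hC x

theorem integrable_gam_iff {f : ℝ → ℝ} :
    Integrable f gam ↔ Integrable (fun x => f x * gaussianPDFReal 0 1 x) := by
  rw [gam, gaussianReal_of_var_ne_zero _ one_ne_zero,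
    integrable_withDensity_iff (measurable_gaussianPDF 0 1) (ae_of_all _ fun _ => gaussianPDF_lt_top)]
  simp [toReal_gaussianPDF]

theorem integral_gam {f : ℝ → ℝ} :
    ∫ x, f x ∂gam = ∫ x, f x * gaussianPDFReal 0 1 x := by
  rw [gam, integral_gaussianReal_eq_integral_smul one_ne_zero]
  simp [mul_comm]

theorem hasDerivAt_pdf (x : ℝ) :
    HasDerivAt (gaussianPDFReal 0 1) (-x * gaussianPDFReal 0 1 x) x := by
  rw [gaussianPDFReal_def]
  have h1 : HasDerivAt (fun x : ℝ => -(x - 0) ^ 2 / (2 * ((1 : NNReal) : ℝ))) (-x) x := by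
    have := (((hasDerivAt_id x).sub_const 0).pow 2).neg.div_const (2 * ((1 : NNReal) : ℝ))
    refine this.congr_deriv ?_
    simp
    ring
  have := h1.exp.const_mul (√(2 * Real.pi * ((1 : NNReal) : ℝ)))⁻¹
  refine this.congr_deriv ?_
  ring

/-- Gaussian integration by parts (bounded functions). -/
theorem gauss_ibp {f f' : ℝ → ℝ} (hf : ∀ x, HasDerivAt f (f' x) x) (hf' : Continuous f')
    {C : ℝ} (hC : ∀ x, |f x| ≤ C) (hC' : ∀ x, |f' x| ≤ C) :
    ∫ g, g * f g ∂gam = ∫ g, f' g ∂gam := by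
  have hfc : Continuous f := continuous_iff_continuousAt.2 fun x => (hf x).continuousAt
  have i1 := integrable_gam_iff.1 (integrable_mul_bdd hfc hC)
  have i2 := integrable_gam_iff.1 (integrable_bdd hf' hC')
  have i3 := integrable_gam_iff.1 (integrable_bdd hfc hC)
  have h := integral_mul_deriv_eq_deriv_mul_of_integrable (u := f) (u' := f')
    (v := gaussianPDFReal 0 1) (v' := fun x => -x * gaussianPDFReal 0 1 x)
    (fun x _ => hf x) (fun x _ => hasDerivAt_pdf x)
    (by
      refine i1.neg.congr (ae_of_all _ fun x => ?_)
      simp only [Pi.neg_apply, Pi.mul_apply]; ring) i2 i3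
  rw [integral_gam, integral_gam]
  have e : ∫ x, f x * (-x * gaussianPDFReal 0 1 x) = -∫ x, x * f x * gaussianPDFReal 0 1 x := by
    rw [← integral_neg]
    congr 1; funext x; ring
  linarith

theorem gauss_ibp_affine {f f' : ℝ → ℝ} (hf : ∀ x, HasDerivAt f (f' x) x) (hf' : Continuous f')
    {C : ℝ} (hC : ∀ x, |f x| ≤ C) (hC' : ∀ x, |f' x| ≤ C) (s h : ℝ) :
    ∫ g, g * f (s * g + h) ∂gam = s * ∫ g, f' (s * g + h) ∂gam := by
  rw [← integral_const_mul]
  have hC0 : 0 ≤ C := (abs_nonneg _).trans (hC 0)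
  refine gauss_ibp (f := fun g => f (s * g + h)) (f' := fun g => s * f' (s * g + h))
    (C := max C (|s| * C)) (fun x => ?_) (by fun_prop) (fun x => (hC _).trans (le_max_left _ _))
    (fun x => ?_)
  · have h1 : HasDerivAt (fun g : ℝ => s * g + h) s x := by
      simpa using ((hasDerivAt_id x).const_mul s).add_const h
    have := (hf (s * x + h)).comp x h1
    rw [mul_comm]
    exact this
  · rw [abs_mul]
    exact le_trans (by gcongr; exact hC' _) (le_max_right _ _)

theorem gauss_fderiv {f f' : ℝ → ℝ} (hf : ∀ x, HasDerivAt f (f' x) x) (hf' : Continuous f')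
    {C : ℝ} (hC : ∀ x, |f x| ≤ C) (hC' : ∀ x, |f' x| ≤ C) (s h : ℝ) :
    HasFDerivAt (fun p : ℝ × ℝ => ∫ g, f (p.1 * g + p.2) ∂gam)
      ((∫ g, g * f' (s * g + h) ∂gam) • ContinuousLinearMap.fst ℝ ℝ ℝ +
        (∫ g, f' (s * g + h) ∂gam) • ContinuousLinearMap.snd ℝ ℝ ℝ) (s, h) := by
  have hfc : Continuous f := continuous_iff_continuousAt.2 fun x => (hf x).continuousAt
  have key := hasFDerivAt_integral_of_dominated_of_fderiv_le (𝕜 := ℝ) (μ := gam)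
    (F := fun (p : ℝ × ℝ) g => f (p.1 * g + p.2))
    (F' := fun p g => (g * f' (p.1 * g + p.2)) • ContinuousLinearMap.fst ℝ ℝ ℝ +
      (f' (p.1 * g + p.2)) • ContinuousLinearMap.snd ℝ ℝ ℝ) (x₀ := (s, h)) (s := univ)
    (bound := fun g => |g| * C + C) univ_mem
    (Eventually.of_forall fun p => (by fun_prop : Continuous fun g => f (p.1 * g + p.2)).aestronglyMeasurable)
    (integrable_bdd (by fun_prop) fun x => hC _)
    (by
      refine Continuous.aestronglyMeasurable ?_
      fun_prop)
    (ae_of_all _ fun g p _ => ?_)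
    ((integrable_id_gam.abs.mul_const C).add (integrable_const C))
    (ae_of_all _ fun g p _ => ?_)
  · refine key.congr_fderiv ?_
    rw [integral_add, integral_smul_const, integral_smul_const]
    · exact (integrable_mul_bdd (f := fun g => f' (s * g + h)) (by fun_prop) fun x => hC' _).smul_const _
    · exact (integrable_bdd (f := fun g => f' (s * g + h)) (by fun_prop) fun x => hC' _).smul_const _
  · have hC0 : 0 ≤ C := (abs_nonneg _).trans (hC 0)
    refine (norm_add_le _ _).trans ?_
    rw [norm_smul, norm_smul, Real.norm_eq_abs, Real.norm_eq_abs, abs_mul]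
    have h1 := ContinuousLinearMap.norm_fst_le ℝ ℝ ℝ
    have h2 := ContinuousLinearMap.norm_snd_le ℝ ℝ ℝ
    have h3 := hC' (p.1 * g + p.2)
    refine add_le_add ?_ ?_
    · calc _ ≤ |g| * C * 1 := by gcongr
        _ = _ := by ring
    · calc _ ≤ C * 1 := by gcongr
        _ = _ := by ring
  · have h1 : HasFDerivAt (fun p : ℝ × ℝ => p.1 * g + p.2)
        (g • ContinuousLinearMap.fst ℝ ℝ ℝ + ContinuousLinearMap.snd ℝ ℝ ℝ) p :=
      (hasFDerivAt_fst.mul_const g).add hasFDerivAt_snd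
    have := (hf (p.1 * g + p.2)).comp_hasFDerivAt p h1
    refine HasFDerivAt.congr_fderiv this ?_
    rw [smul_add, smul_smul, mul_comm]

/-- Gaussian smoothing of `f`. -/
def Ex (f : ℝ → ℝ) (s h : ℝ) : ℝ := ∫ g, f (s * g + h) ∂gam

def ft (x : ℝ) : ℝ := Real.tanh x
def ft2 (x : ℝ) : ℝ := Real.tanh x ^ 2
def fS (x : ℝ) : ℝ := 1 - Real.tanh x ^ 2
def fR (x : ℝ) : ℝ := Real.tanh x * (1 - Real.tanh x ^ 2)
def fW (x : ℝ) : ℝ := Real.tanh x ^ 2 * (1 - Real.tanh x ^ 2)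
def fS4 (x : ℝ) : ℝ := (1 - Real.tanh x ^ 2) ^ 2

theorem cft : Continuous ft := by unfold ft; fun_prop
theorem cft2 : Continuous ft2 := by unfold ft2; fun_prop
theorem cfS : Continuous fS := by unfold fS; fun_prop
theorem cfR : Continuous fR := by unfold fR; fun_prop
theorem cfW : Continuous fW := by unfold fW; fun_prop
theorem cfS4 : Continuous fS4 := by unfold fS4; fun_prop

theorem bft (x : ℝ) : |ft x| ≤ 1 := (Real.abs_tanh_lt_one x).le
theorem fS_nonneg (x : ℝ) : 0 ≤ fS x := by unfold fS; linarith [tsq_le x]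
theorem fW_nonneg (x : ℝ) : 0 ≤ fW x := mul_nonneg (sq_nonneg _) (fS_nonneg x)
theorem bft2 (x : ℝ) : |ft2 x| ≤ 1 := by
  unfold ft2; rw [abs_of_nonneg (sq_nonneg _)]; exact tsq_le x
theorem bfS (x : ℝ) : |fS x| ≤ 1 := by
  rw [abs_of_nonneg (fS_nonneg x)]; unfold fS; linarith [sq_nonneg (Real.tanh x)]
theorem bfR (x : ℝ) : |fR x| ≤ 1 := by
  have : fR x = ft x * fS x := rfl
  rw [this, abs_mul]
  exact mul_le_one₀ (bft x) (abs_nonneg _) (bfS x)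
theorem bfW (x : ℝ) : |fW x| ≤ 1 := by
  have : fW x = ft2 x * fS x := rfl
  rw [this, abs_mul]
  exact mul_le_one₀ (bft2 x) (abs_nonneg _) (bfS x)
theorem bfS4 (x : ℝ) : |fS4 x| ≤ 1 := by
  have : fS4 x = fS x * fS x := by unfold fS4 fS; ring
  rw [this, abs_mul]
  exact mul_le_one₀ (bfS x) (abs_nonneg _) (bfS x)

theorem int_ex {f : ℝ → ℝ} (hf : Continuous f) {C : ℝ} (hC : ∀ x, |f x| ≤ C) (s h : ℝ) :
    Integrable (fun g => f (s * g + h)) gam :=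
  integrable_bdd (by fun_prop) fun x => hC _

theorem hdS (x : ℝ) : HasDerivAt fS (-2 * fR x) x := by
  have := ((hasDerivAt_tanh' x).pow 2).const_sub 1
  refine HasDerivAt.congr_deriv this ?_
  simp [fR]; ring

theorem hdR (x : ℝ) : HasDerivAt fR (fS4 x - 2 * fW x) x := by
  have := (hasDerivAt_tanh' x).mul (hdS x)
  refine HasDerivAt.congr_deriv this ?_
  simp [fR, fS, fS4, fW]; ring

theorem hdt2 (x : ℝ) : HasDerivAt ft2 (2 * fR x) x := by
  have := ((hasDerivAt_tanh' x).pow 2)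
  refine HasDerivAt.congr_deriv this ?_
  simp [fR]; ring

theorem ex_lin {f k : ℝ → ℝ} (hf : Continuous f) (hk : Continuous k)
    (hC : ∀ x, |f x| ≤ 1) (hk1 : ∀ x, |k x| ≤ 1) (s h c : ℝ) :
    ∫ g, (f (s * g + h) - c * k (s * g + h)) ∂gam = Ex f s h - c * Ex k s h := by
  rw [integral_sub (int_ex hf hC s h) ((int_ex hk hk1 s h).const_mul c), integral_const_mul]
  rfl

theorem fdT1 (s h : ℝ) : HasFDerivAt (fun p : ℝ × ℝ => Ex ft p.1 p.2)
    ((-2 * s * Ex fR s h) • ContinuousLinearMap.fst ℝ ℝ ℝ +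
      (Ex fS s h) • ContinuousLinearMap.snd ℝ ℝ ℝ) (s, h) := by
  have h1 := gauss_fderiv (f := ft) (f' := fS) hasDerivAt_tanh' cfS bft bfS s h
  have h2 := gauss_ibp_affine (f := fS) (f' := fun x => -2 * fR x) (C := 2) hdS
    (by have := cfR; fun_prop) (fun x => (bfS x).trans (by norm_num))
    (fun x => by rw [abs_mul]; have := bfR x; norm_num; linarith) s h
  rw [h2, integral_const_mul] at h1
  refine h1.congr_fderiv ?_
  unfold Ex
  congr 2
  ring

theorem fdT2 (s h : ℝ) : HasFDerivAt (fun p : ℝ × ℝ => Ex ft2 p.1 p.2)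
    ((2 * s * (Ex fS4 s h - 2 * Ex fW s h)) • ContinuousLinearMap.fst ℝ ℝ ℝ +
      (2 * Ex fR s h) • ContinuousLinearMap.snd ℝ ℝ ℝ) (s, h) := by
  have cR := cfR
  have h1 := gauss_fderiv (f := ft2) (f' := fun x => 2 * fR x) (C := 2) hdt2 (by fun_prop)
    (fun x => (bft2 x).trans (by norm_num))
    (fun x => by rw [abs_mul]; have := bfR x; norm_num; linarith) s h
  have h2 := gauss_ibp_affine (f := fR) (f' := fun x => fS4 x - 2 * fW x) (C := 3) hdR
    (by have := cfS4; have := cfW; fun_prop) (fun x => (bfR x).trans (by norm_num))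
    (fun x => by
      have a1 := abs_le.1 (bfS4 x)
      have a2 := abs_le.1 (bfW x)
      rw [abs_le]; constructor <;> linarith) s h
  rw [ex_lin cfS4 cfW bfS4 bfW] at h2
  have h3 : ∫ g, g * (2 * fR (s * g + h)) ∂gam = 2 * ∫ g, g * fR (s * g + h) ∂gam := by
    rw [← integral_const_mul]; congr 1; funext g; ring
  rw [h3, h2, integral_const_mul] at h1
  refine h1.congr_fderiv ?_
  unfold Ex
  congr 2
  ring

theorem fdR (s h : ℝ) : HasDerivAt (fun h => Ex fS s h) (-2 * Ex fR s h) h := by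
  have cR := cfR
  have h1 := gauss_fderiv (f := fS) (f' := fun x => -2 * fR x) (C := 2) hdS (by fun_prop)
    (fun x => (bfS x).trans (by norm_num))
    (fun x => by rw [abs_mul]; have := bfR x; norm_num; linarith) s h
  have h2 := h1.comp_hasDerivAt h ((hasDerivAt_const h s).prodMk (hasDerivAt_id h))
  refine HasDerivAt.congr_deriv h2 ?_
  rw [integral_const_mul]
  simp [Ex]

theorem dT1 (s h : ℝ) : HasDerivAt (fun h => Ex ft s h) (Ex fS s h) h := by
  have h2 := (fdT1 s h).comp_hasDerivAt h ((hasDerivAt_const h s).prodMk (hasDerivAt_id h))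
  refine HasDerivAt.congr_deriv h2 ?_
  simp

theorem cs_ineq (s h : ℝ) : Ex fR s h ^ 2 ≤ Ex fS s h * Ex fW s h := by
  have key : ∀ x : ℝ, 0 ≤ Ex fS s h * (x * x) + (-2 * Ex fR s h) * x + Ex fW s h := by
    intro x
    have e : Ex fS s h * (x * x) + (-2 * Ex fR s h) * x + Ex fW s h =
        ∫ g, fS (s * g + h) * (Real.tanh (s * g + h) - x) ^ 2 ∂gam := by
      have e1 : (fun g => fS (s * g + h) * (Real.tanh (s * g + h) - x) ^ 2) =
          fun g => (fW (s * g + h) - (2 * x) * fR (s * g + h)) + (x * x) * fS (s * g + h) := by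
        funext g; simp only [fS, fW, fR]; ring
      rw [e1, integral_add, ex_lin cfW cfR bfW bfR, integral_const_mul]
      · simp only [Ex]; ring
      · exact (int_ex cfW bfW s h).sub ((int_ex cfR bfR s h).const_mul _)
      · exact (int_ex cfS bfS s h).const_mul _
    rw [e]
    exact integral_nonneg fun g => mul_nonneg (fS_nonneg _) (sq_nonneg _)
  have := discrim_le_zero key
  unfold discrim at this
  nlinarith

theorem Ex_odd (s : ℝ) : Ex ft s 0 = 0 := by
  have h : Ex ft s 0 = - Ex ft s 0 := by
    unfold Ex
    have e : gam = gam.map (fun x => -x) := by rw [gaussianReal_map_neg]; simp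
    conv_lhs => rw [e]
    rw [integral_map (by fun_prop)
      ((by have := cft; fun_prop : Continuous fun g => ft (s * g + 0)).aestronglyMeasurable), ← integral_neg]
    congr 1; funext g
    simp only [ft, add_zero, mul_neg, Real.tanh_neg]
  linarith

theorem R_pos {s h : ℝ} (hs : 0 < s) (hh : 0 < h) : 0 < Ex fR s h := by
  set ρ := gaussianPDFReal 0 1 with hρ
  have cR := cfR
  have cρ : Continuous ρ := continuous_iff_continuousAt.2 fun x => (hasDerivAt_pdf x).continuousAt
  have i1 : Integrable (fun x => fR (s * x + h) * ρ x) := integrable_gam_iff.1 (int_ex cfR bfR s h)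
  have odd : ∀ x, fR (-x) = -fR x := fun x => by simp [fR]
  have e0 : Ex fR s h = ∫ x, fR (s * x + h) * ρ x := integral_gam
  have refl : ∀ x, fR (s * (-(2 * h / s) - x) + h) = -fR (s * x + h) := by
    intro x
    rw [← odd]; congr 1; field_simp; ring
  have i2 : Integrable (fun x => fR (s * x + h) * ρ (-(2 * h / s) - x)) := by
    have := (i1.comp_sub_left (-(2 * h / s))).neg
    refine this.congr (ae_of_all _ fun x => ?_)
    simp only [Pi.neg_apply, refl]; ring
  have e1 : Ex fR s h = -∫ x, fR (s * x + h) * ρ (-(2 * h / s) - x) := by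
    rw [e0, ← integral_sub_left_eq_self _ volume (-(2 * h / s)), ← integral_neg]
    congr 1; funext x
    rw [refl]; ring
  have e2 : 2 * Ex fR s h = ∫ x, fR (s * x + h) * (ρ x - ρ (-(2 * h / s) - x)) := by
    have : (fun x => fR (s * x + h) * (ρ x - ρ (-(2 * h / s) - x))) =
      fun x => fR (s * x + h) * ρ x - fR (s * x + h) * ρ (-(2 * h / s) - x) := by
        funext x; ring
    rw [this, integral_sub i1 i2]; linarith
  have ρlt : ∀ x y : ℝ, x ^ 2 < y ^ 2 → ρ y < ρ x := by
    intro x y hxy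
    simp only [hρ, gaussianPDFReal_def]
    have : 0 < (√(2 * Real.pi * ((1 : NNReal) : ℝ)))⁻¹ := by
      simp only [NNReal.coe_one]
      positivity
    refine mul_lt_mul_of_pos_left (Real.exp_lt_exp.2 ?_) this
    simp; linarith
  have fpos : ∀ x, 0 < x → 0 < fR x := fun x hx => by
    have h1 := Real.tanh_sq_lt_one x
    exact mul_pos (tanh_pos' hx) (by linarith)
  have hd : 0 < h / s := div_pos hh hs
  have e3 : ∀ x, s * x + h = s * (x + h / s) := fun x => by field_simp
  have pos : ∀ x, 0 < s * x + h → 0 < fR (s * x + h) * (ρ x - ρ (-(2 * h / s) - x)) := by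
    intro x hx
    refine mul_pos (fpos _ hx) (sub_pos.2 (ρlt _ _ ?_))
    have : 0 < x + h / s := by
      rw [e3] at hx; exact pos_of_mul_pos_right hx hs.le
    have e : 2 * h / s = 2 * (h / s) := by ring
    rw [e]; nlinarith
  have nonneg : ∀ x, 0 ≤ fR (s * x + h) * (ρ x - ρ (-(2 * h / s) - x)) := by
    intro x
    rcases lt_trichotomy (s * x + h) 0 with hx | hx | hx
    · refine mul_nonneg_of_nonpos_of_nonpos ?_ (sub_nonpos.2 (ρlt _ _ ?_).le)
      · have := fpos (-(s * x + h)) (by linarith)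
        rw [odd] at this; linarith
      · have : x + h / s < 0 := by
          rw [e3] at hx; exact neg_of_mul_neg_right hx hs.le
        have e : 2 * h / s = 2 * (h / s) := by ring
        rw [e]; nlinarith
    · rw [hx]; simp [fR]
    · exact (pos x hx).le
  have : 0 < ∫ x, fR (s * x + h) * (ρ x - ρ (-(2 * h / s) - x)) := by
    refine integral_pos_of_integrable_nonneg_nonzero (x := 0) (by fun_prop) ?_ (fun x => nonneg x) (pos 0 (by simpa using hh)).ne'
    refine (i1.sub i2).congr (ae_of_all _ fun x => ?_)
    simp only [Pi.sub_apply]; ring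
  linarith

theorem concave_ineq {s h : ℝ} (hs : 0 < s) (hh : 0 < h) : h * Ex fS s h < Ex ft s h := by
  obtain ⟨c, hc, e⟩ := exists_hasDerivAt_eq_slope (fun h => Ex ft s h) (fun h => Ex fS s h) hh
    (fun x _ => (dT1 s x).continuousAt.continuousWithinAt) (fun x _ => dT1 s x)
  have anti : StrictAntiOn (fun h => Ex fS s h) (Icc 0 h) := by
    refine strictAntiOn_of_deriv_neg (convex_Icc _ _)
      (fun x _ => (fdR s x).continuousAt.continuousWithinAt) fun x hx => ?_
    rw [interior_Icc] at hx
    rw [(fdR s x).deriv]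
    linarith [R_pos hs hx.1]
  have h1 := anti ⟨hc.1.le, hc.2.le⟩ ⟨hh.le, le_rfl⟩ hc.2
  simp only [Ex_odd, sub_zero] at e h1
  rw [eq_div_iff hh.ne'] at e
  nlinarith

theorem Ex_cont2 (β : ℝ) {X : Type*} [TopologicalSpace X] {u v : X → ℝ} (hu : Continuous u)
    (hv : Continuous v) : Continuous (fun x => Ex ft2 (β * √(u x)) (v x)) := by
  have h1 : Continuous (fun p : ℝ × ℝ => Ex ft2 p.1 p.2) :=
    continuous_iff_continuousAt.2 fun p => (fdT2 p.1 p.2).continuousAt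
  have h2 : Continuous (fun x => (β * √(u x), v x)) := by fun_prop
  exact Continuous.comp (g := fun p : ℝ × ℝ => Ex ft2 p.1 p.2) (f := fun x => (β * √(u x), v x)) h1 h2

theorem Ex_zero (f : ℝ → ℝ) (h : ℝ) : Ex f 0 h = f h := by simp [Ex]

theorem Ex_ft2_le (s h : ℝ) : Ex ft2 s h ≤ 1 := by
  have := integral_mono (μ := gam) (int_ex cft2 bft2 s h) (integrable_const (1 : ℝ))
    (fun g => tsq_le (s * g + h))
  rw [integral_const] at this
  simpa [Ex] using this

theorem conv_ex (f : ℝ → ℝ) (β q h : ℝ) :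
    ∫ g, f (β * g * √q + h) ∂(_root_.stdGaussian) = Ex f (β * √q) h := by
  unfold Ex _root_.stdGaussian
  congr 1; funext g; congr 1; ring

theorem qO_eq {β h : ℝ} (hh : h ≠ 0) :
    qOverlap β h = sSup {q : ℝ | q ∈ Ioc (0 : ℝ) 1 ∧ q = Ex ft2 (β * √q) h} := by
  unfold qOverlap
  rw [if_neg hh]
  congr 1; ext q
  rw [mem_ofPred_eq, mem_ofPred_eq, ← conv_ex ft2]
  rfl

theorem ft2_pos {h : ℝ} (hh : h ≠ 0) : 0 < ft2 h := by
  unfold ft2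
  rcases lt_or_gt_of_ne hh with h1 | h1
  · have := tanh_pos' (x := -h) (by linarith)
    rw [Real.tanh_neg] at this
    nlinarith
  · have := tanh_pos' h1
    positivity

theorem q_set_ne {β h : ℝ} (hh : h ≠ 0) {a : ℝ} (ha : a ∈ Icc (0 : ℝ) 1)
    (haF : a ≤ Ex ft2 (β * √a) h) :
    ∃ q, a ≤ q ∧ q ∈ Ioc (0 : ℝ) 1 ∧ q = Ex ft2 (β * √q) h := by
  have hc : Continuous (fun q : ℝ => q - Ex ft2 (β * √q) h) :=
    continuous_id.sub (Ex_cont2 β continuous_id continuous_const)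
  have := intermediate_value_Icc ha.2 hc.continuousOn
  obtain ⟨q, hq, e⟩ := this (show (0 : ℝ) ∈ _ from
    ⟨by linarith, by have := Ex_ft2_le (β * √1) h; linarith⟩)
  have e' : q = Ex ft2 (β * √q) h := by simp only at e; linarith
  refine ⟨q, hq.1, ⟨lt_of_le_of_ne (ha.1.trans hq.1) ?_, hq.2⟩, e'⟩
  rintro rfl
  rw [Real.sqrt_zero, mul_zero, Ex_zero] at e'
  exact (ft2_pos hh).ne e'

theorem q_max {β h : ℝ} (hh : h ≠ 0) {a : ℝ} (ha : a ∈ Icc (0 : ℝ) 1)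
    (haF : a ≤ Ex ft2 (β * √a) h) : a ≤ qOverlap β h := by
  obtain ⟨q, h1, h2, h3⟩ := q_set_ne hh ha haF
  rw [qO_eq hh]
  exact h1.trans (le_csSup ⟨1, fun x hx => hx.1.2⟩ ⟨h2, h3⟩)

theorem q_spec {β h : ℝ} (hh : h ≠ 0) :
    qOverlap β h ∈ Ioc (0 : ℝ) 1 ∧ qOverlap β h = Ex ft2 (β * √(qOverlap β h)) h := by
  have hS : {q : ℝ | q ∈ Ioc (0 : ℝ) 1 ∧ q = Ex ft2 (β * √q) h} =
      Icc 0 1 ∩ {q : ℝ | q = Ex ft2 (β * √q) h} := by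
    ext q
    constructor
    · rintro ⟨h1, h2⟩; exact ⟨⟨h1.1.le, h1.2⟩, h2⟩
    · rintro ⟨h1, h2⟩
      refine ⟨⟨lt_of_le_of_ne h1.1 ?_, h1.2⟩, h2⟩
      rintro rfl
      simp only [mem_ofPred_eq] at h2
      rw [Real.sqrt_zero, mul_zero, Ex_zero] at h2
      exact (ft2_pos hh).ne h2
  have hK : IsCompact {q : ℝ | q ∈ Ioc (0 : ℝ) 1 ∧ q = Ex ft2 (β * √q) h} := by
    rw [hS]
    exact isCompact_Icc.inter_right (isClosed_eq continuous_id
      (Ex_cont2 β continuous_id continuous_const))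
  have hne : {q : ℝ | q ∈ Ioc (0 : ℝ) 1 ∧ q = Ex ft2 (β * √q) h}.Nonempty := by
    obtain ⟨q, _, h2⟩ := q_set_ne (β := β) hh (a := 0) ⟨le_rfl, zero_le_one⟩
      (by rw [Real.sqrt_zero, mul_zero, Ex_zero]; exact (ft2_pos hh).le)
    exact ⟨q, h2⟩
  have := hK.sSup_mem hne
  rw [← qO_eq hh] at this
  exact this

theorem implicit_deriv {Q : ℝ → ℝ} {Fn : ℝ × ℝ → ℝ} {h0 a b : ℝ} (hQ : ContinuousAt Q h0)
    (hfix : ∀ᶠ h in 𝓝 h0, Q h = Fn (Q h, h))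
    (hF : HasFDerivAt Fn (a • ContinuousLinearMap.fst ℝ ℝ ℝ + b • ContinuousLinearMap.snd ℝ ℝ ℝ)
      (Q h0, h0)) (ha : a < 1) : HasDerivAt Q (b / (1 - a)) h0 := by
  have h1a : 0 < 1 - a := by linarith
  set d := b / (1 - a) with hd
  have hdb : d * (1 - a) = b := by rw [hd]; field_simp
  have hG : Tendsto (fun h => (Q h, h)) (𝓝 h0) (𝓝 (Q h0, h0)) :=
    (hQ.prodMk continuousAt_id).tendsto
  have ho := (hasFDerivAt_iff_isLittleO.1 hF).comp_tendsto hG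
  rw [hasDerivAt_iff_isLittleO, Asymptotics.isLittleO_iff]
  intro c hc
  set B := |d| + 1 with hB
  have hB0 : 0 < B := by positivity
  set ε := min ((1 - a) / 2) (c * (1 - a) / (2 * B)) with hε
  have hε0 : 0 < ε := by positivity
  have h2 := (Asymptotics.isLittleO_iff.1 ho) hε0
  have hf0 := hfix.self_of_nhds
  filter_upwards [h2, hfix] with h hh hf
  simp only [Function.comp_apply] at hh
  rw [← hf, ← hf0] at hh
  simp only [smul_eq_mul, Real.norm_eq_abs, _root_.add_apply,
    _root_.smul_apply, ContinuousLinearMap.coe_fst', ContinuousLinearMap.coe_snd',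
    Prod.mk_sub_mk, Prod.norm_mk] at hh ⊢
  set r := Q h - Q h0 - (h - h0) * d with hr
  have e1 : Q h - Q h0 - (a * (Q h - Q h0) + b * (h - h0)) = (1 - a) * r := by
    rw [hr, ← hdb]; ring
  rw [e1, abs_mul, abs_of_pos h1a] at hh
  have e2 : max |Q h - Q h0| |h - h0| ≤ |r| + B * |h - h0| := by
    have : Q h - Q h0 = r + (h - h0) * d := by rw [hr]; ring
    refine max_le ?_ ?_
    · rw [this]
      refine (abs_add_le _ _).trans ?_
      rw [abs_mul, hB]
      nlinarith [abs_nonneg (h - h0)]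
    · rw [hB]; nlinarith [abs_nonneg (h - h0), abs_nonneg r, abs_nonneg d]
  have e3 : ε ≤ (1 - a) / 2 := min_le_left _ _
  have e4 : ε * B ≤ c * (1 - a) / 2 := by
    have := min_le_right ((1 - a) / 2) (c * (1 - a) / (2 * B))
    rw [← hε] at this
    calc ε * B ≤ c * (1 - a) / (2 * B) * B := by gcongr
      _ = _ := by field_simp
  have e5 : (1 - a) * |r| ≤ ε * |r| + ε * B * |h - h0| := by
    refine hh.trans ?_
    calc _ ≤ ε * (|r| + B * |h - h0|) := by gcongr
      _ = _ := by ring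
  have e6 : (1 - a) * |r| ≤ (1 - a) * (c * |h - h0|) := by
    have := mul_le_mul_of_nonneg_right e3 (abs_nonneg r)
    have := mul_le_mul_of_nonneg_right e4 (abs_nonneg (h - h0))
    linarith
  exact le_of_mul_le_mul_left e6 h1a

theorem fd_comp {β q h : ℝ} (hq : 0 < q) {f : ℝ → ℝ} {A b : ℝ}
    (hf : HasFDerivAt (fun p : ℝ × ℝ => Ex f p.1 p.2)
      ((2 * (β * √q) * A) • ContinuousLinearMap.fst ℝ ℝ ℝ +
        b • ContinuousLinearMap.snd ℝ ℝ ℝ) (β * √q, h)) :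
    HasFDerivAt (fun p : ℝ × ℝ => Ex f (β * √p.1) p.2)
      ((β ^ 2 * A) • ContinuousLinearMap.fst ℝ ℝ ℝ +
        b • ContinuousLinearMap.snd ℝ ℝ ℝ) (q, h) := by
  have h1 : HasFDerivAt (fun p : ℝ × ℝ => (β * √p.1, p.2))
      ((β • ((1 / (2 * √q)) • ContinuousLinearMap.fst ℝ ℝ ℝ)).prod
        (ContinuousLinearMap.snd ℝ ℝ ℝ)) (q, h) := by
    refine HasFDerivAt.prodMk ?_ hasFDerivAt_snd
    exact ((Real.hasDerivAt_sqrt hq.ne').comp_hasFDerivAt (q, h)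
      (hasFDerivAt_fst (𝕜 := ℝ) (p := (q, h)))).const_mul β
  have h2 := HasFDerivAt.comp (q, h) (g := fun p : ℝ × ℝ => Ex f p.1 p.2) hf h1
  refine HasFDerivAt.congr_fderiv h2 ?_
  have : √q ≠ 0 := (Real.sqrt_pos.2 hq).ne'
  ext
  · simp
    field_simp
  · simp

theorem q_continuousAt {β h0 : ℝ} (hh : h0 ≠ 0) {a b : ℝ} (ha : a < 1)
    (hF : HasFDerivAt (fun p : ℝ × ℝ => Ex ft2 (β * √p.1) p.2)
      (a • ContinuousLinearMap.fst ℝ ℝ ℝ + b • ContinuousLinearMap.snd ℝ ℝ ℝ)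
      (qOverlap β h0, h0)) : ContinuousAt (qOverlap β) h0 := by
  have hev : ∀ᶠ h in 𝓝 h0, h ≠ 0 := isOpen_ne.mem_nhds hh
  obtain ⟨hm, he⟩ := q_spec (β := β) hh
  set q0 := qOverlap β h0 with hq0
  refine tendsto_order.2 ⟨fun c hc => ?_, fun c hc => ?_⟩
  · have hd : HasDerivAt (fun q => Ex ft2 (β * √q) h0 - q) (a - 1) q0 := by
      have := (hF.comp_hasDerivAt q0 ((hasDerivAt_id q0).prodMk (hasDerivAt_const q0 h0))).sub
        (hasDerivAt_id q0)
      refine HasDerivAt.congr_deriv this ?_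
      simp
    have hs := (hasDerivAt_iff_tendsto_slope.1 hd)
    have hs' : Tendsto (slope (fun q => Ex ft2 (β * √q) h0 - q) q0) (𝓝[<] q0) (𝓝 (a - 1)) :=
      hs.mono_left (nhdsWithin_mono _ fun x hx => ne_of_lt hx)
    have h1 := hs'.eventually (Iio_mem_nhds (show a - 1 < 0 by linarith))
    have h2 : ∀ᶠ x in 𝓝[<] q0, x ∈ Ioo (max c 0) q0 :=
      Ioo_mem_nhdsLT (max_lt hc hm.1)
    obtain ⟨x, hx1, hx2⟩ := (h1.and h2).exists
    simp only [slope_def_field, ← he, sub_self, sub_zero] at hx1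
    have hx3 : x < Ex ft2 (β * √x) h0 := by
      have : x - q0 < 0 := by linarith [hx2.2]
      rw [div_neg_iff] at hx1
      rcases hx1 with h | h <;> linarith [h.1, h.2]
    have hcont : ContinuousAt (fun h => Ex ft2 (β * √x) h) h0 :=
      (Ex_cont2 β continuous_const continuous_id).continuousAt
    filter_upwards [hcont.eventually (Ioi_mem_nhds hx3), hev] with h h3 h4
    have hc' := (max_lt_iff.1 hx2.1)
    exact hc'.1.trans_le (q_max h4 ⟨hc'.2.le, hx2.2.le.trans hm.2⟩ (le_of_lt h3))
  · have hK : ∀ q ∈ Icc c 1, ∀ᶠ z : ℝ × ℝ in 𝓝 h0 ×ˢ 𝓝 q, Ex ft2 (β * √z.2) z.1 < z.2 := by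
      intro q hq
      have h1 : Ex ft2 (β * √q) h0 < q := by
        by_contra hcon
        have := q_max hh (β := β) ⟨hm.1.le.trans (hc.le.trans hq.1), hq.2⟩ (not_lt.1 hcon)
        rw [← hq0] at this
        linarith [hq.1]
      rw [← nhds_prod_eq]
      have cc : Continuous (fun z : ℝ × ℝ => Ex ft2 (β * √z.2) z.1) :=
        Ex_cont2 β continuous_snd continuous_fst
      exact (isOpen_lt cc continuous_snd).mem_nhds h1
    have := isCompact_Icc.eventually_forall_of_forall_eventually (P := fun h q => Ex ft2 (β * √q) h < q)
      (x₀ := h0) (fun q hq => by rw [nhds_prod_eq]; exact hK q hq)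
    filter_upwards [this, hev] with h h3 h4
    obtain ⟨hm', he'⟩ := q_spec (β := β) h4
    by_contra hcon
    have := h3 _ ⟨not_lt.1 hcon, hm'.2⟩
    linarith

theorem main_deriv {β h0 : ℝ} (hβ : 0 < β) (hh : h0 ≠ 0) (hAT : ATCond β h0) :
    ∃ D, 0 ≤ D ∧ D ≤ Ex fS (β * √(qOverlap β h0)) h0 ∧
      HasDerivAt (fun h => Ex ft (β * √(qOverlap β h)) h) D h0 := by
  obtain ⟨hm, he⟩ := q_spec (β := β) hh
  set q0 := qOverlap β h0 with hq0
  set s := β * √q0 with hs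
  have hAT' : β ^ 2 * Ex fS4 s h0 < 1 := by
    unfold ATCond at hAT
    rw [conv_ex (fun x => sech x ^ 4)] at hAT
    have : (fun x => sech x ^ 4) = fS4 := by funext x; exact sech_sq x
    rwa [this] at hAT
  have hW : 0 ≤ Ex fW s h0 := integral_nonneg fun g => fW_nonneg _
  have hS : 0 ≤ Ex fS s h0 := integral_nonneg fun g => fS_nonneg _
  have hF := fd_comp (β := β) (h := h0) hm.1 (fdT2 (β * √q0) h0)
  rw [← hs] at hF
  set a := β ^ 2 * (Ex fS4 s h0 - 2 * Ex fW s h0) with ha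
  have ha' : 1 - a = 1 - β ^ 2 * Ex fS4 s h0 + 2 * β ^ 2 * Ex fW s h0 := by rw [ha]; ring
  have hb2 : 0 < β ^ 2 := by positivity
  have ha1 : 0 < 1 - a := by
    have := mul_nonneg hb2.le hW
    rw [ha']; linarith
  have hQ := implicit_deriv (q_continuousAt hh (by linarith) hF)
    (by
      have hev : ∀ᶠ h in 𝓝 h0, h ≠ 0 := isOpen_ne.mem_nhds hh
      filter_upwards [hev] with h h4
      exact (q_spec h4).2) hF (by linarith)
  have hT := fd_comp (β := β) (h := h0) (A := -Ex fR s h0) (b := Ex fS s h0) (f := ft) hm.1 (by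
    refine (fdT1 (β * √q0) h0).congr_fderiv ?_
    rw [← hs]; congr 2; ring)
  have hpair : HasDerivAt (fun h => (qOverlap β h, h)) (2 * Ex fR s h0 / (1 - a), (1 : ℝ)) h0 :=
    hQ.prodMk (hasDerivAt_id' h0)
  have hD := HasFDerivAt.comp_hasDerivAt (f := fun h => (qOverlap β h, h)) h0 hT hpair
  have hcs := cs_ineq s h0
  set R := Ex fR s h0
  set S := Ex fS s h0
  set W := Ex fW s h0
  refine ⟨S - 2 * β ^ 2 * R ^ 2 / (1 - a), ?_, ?_, HasDerivAt.congr_deriv hD ?_⟩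
  · rw [sub_nonneg, div_le_iff₀ ha1, ha']
    have h1 : β ^ 2 * R ^ 2 ≤ β ^ 2 * (S * W) := by gcongr
    have h2 : 0 ≤ S * (1 - β ^ 2 * Ex fS4 s h0) := mul_nonneg hS (by linarith)
    nlinarith
  · have : 0 ≤ 2 * β ^ 2 * R ^ 2 / (1 - a) := by positivity
    linarith
  · simp
    field_simp
    ring

theorem abs_tanh_le (x : ℝ) : |Real.tanh x| ≤ |x| := by
  have := Convex.norm_image_sub_le_of_norm_hasDerivWithin_le (f := Real.tanh)
    (f' := fun x => 1 - Real.tanh x ^ 2) (C := 1) (s := univ) (x := 0) (y := x)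
    (fun x _ => (hasDerivAt_tanh' x).hasDerivWithinAt) (fun x _ => bfS x) convex_univ
    (mem_univ _) (mem_univ _)
  simpa using this

theorem tanh_sub_le (x : ℝ) : |Real.tanh x - x| ≤ x ^ 2 := by
  have := Convex.norm_image_sub_le_of_norm_hasDerivWithin_le (f := fun x => Real.tanh x - x)
    (f' := fun x => 1 - Real.tanh x ^ 2 - 1) (C := |x|) (s := uIcc 0 x) (x := 0) (y := x)
    (fun y _ => ((hasDerivAt_tanh' y).sub (hasDerivAt_id y)).hasDerivWithinAt) (fun y hy => ?_)
    (convex_uIcc _ _) left_mem_uIcc right_mem_uIcc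
  · simp only [Real.tanh_zero, sub_zero, Real.norm_eq_abs] at this
    rwa [← sq, sq_abs] at this
  · have h1 : |y| ≤ |x| := by simpa using abs_sub_left_of_mem_uIcc hy
    have h2 : 1 - Real.tanh y ^ 2 - 1 = -(Real.tanh y ^ 2) := by ring
    rw [h2, norm_neg, Real.norm_eq_abs, abs_of_nonneg (sq_nonneg _), ← sq_abs]
    have := abs_tanh_le y
    have := (Real.abs_tanh_lt_one y).le
    nlinarith [abs_nonneg (Real.tanh y)]

theorem int_affine_sq (s h : ℝ) : Integrable (fun g : ℝ => (s * g + h) ^ 2) gam ∧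
    ∫ g, (s * g + h) ^ 2 ∂gam = s ^ 2 + h ^ 2 := by
  have e : (fun g : ℝ => (s * g + h) ^ 2) = fun g => (s ^ 2 * g ^ 2 + (2 * s * h) * g) + h ^ 2 := by
    funext g; ring
  have i1 := integrable_sq_gam.const_mul (s ^ 2)
  have i2 := integrable_id_gam.const_mul (2 * s * h)
  rw [e]
  refine ⟨(i1.add i2).add (integrable_const _), ?_⟩
  have i3 : Integrable (fun g : ℝ => s ^ 2 * g ^ 2 + (2 * s * h) * g) gam := i1.add i2
  rw [integral_add i3 (integrable_const _), integral_add i1 i2, integral_const_mul,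
    integral_const_mul, integral_id_gam, integral_sq_gam]
  simp

theorem Ex_ft2_bound (s h : ℝ) : Ex ft2 s h ≤ s ^ 2 + h ^ 2 := by
  obtain ⟨i, e⟩ := int_affine_sq s h
  rw [← e]
  refine integral_mono (int_ex cft2 bft2 s h) i fun g => ?_
  exact sq_le_sq.2 (abs_tanh_le _)

theorem Ex_ft_bound (s h : ℝ) : |Ex ft s h - h| ≤ s ^ 2 + h ^ 2 := by
  obtain ⟨i, e⟩ := int_affine_sq s h
  have i2 : Integrable (fun g : ℝ => s * g + h) gam :=
    (integrable_id_gam.const_mul s).add (integrable_const h)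
  have e2 : ∫ g, (s * g + h) ∂gam = h := by
    rw [integral_add (integrable_id_gam.const_mul s) (integrable_const h), integral_const_mul,
      integral_id_gam]
    simp
  have : Ex ft s h - h = ∫ g, (ft (s * g + h) - (s * g + h)) ∂gam := by
    rw [integral_sub (int_ex cft bft s h) i2, e2]; rfl
  rw [this, ← e]
  refine (abs_integral_le_integral_abs).trans ?_
  exact integral_mono ((int_ex cft bft s h).sub i2).abs i fun g => tanh_sub_le _

theorem T1_deriv_zero {β : ℝ} (hβ : 0 < β) (hβ1 : β < 1) :
    HasDerivAt (fun h => Ex ft (β * √(qOverlap β h)) h) 1 0 := by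
  have hb : 0 < 1 - β ^ 2 := by nlinarith
  have hbd : ∀ h, |Ex ft (β * √(qOverlap β h)) h - h| ≤ (1 / (1 - β ^ 2)) * h ^ 2 := by
    intro h
    rcases eq_or_ne h 0 with rfl | hh
    · simp [Ex_odd]
    · obtain ⟨hm, he⟩ := q_spec (β := β) hh
      have h1 := Ex_ft2_bound (β * √(qOverlap β h)) h
      rw [← he] at h1
      refine (Ex_ft_bound _ _).trans ?_
      rw [mul_pow, Real.sq_sqrt hm.1.le] at h1 ⊢
      rw [div_mul_eq_mul_div, le_div_iff₀ hb]
      nlinarith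
  rw [hasDerivAt_iff_isLittleO]
  have h0 : Ex ft (β * √(qOverlap β 0)) 0 = 0 := Ex_odd _
  have hO : (fun h => Ex ft (β * √(qOverlap β h)) h - Ex ft (β * √(qOverlap β 0)) 0 - (h - 0) • (1 : ℝ))
      =O[𝓝 0] fun h : ℝ => h ^ 2 := by
    refine Asymptotics.IsBigO.of_bound (1 / (1 - β ^ 2)) (Eventually.of_forall fun h => ?_)
    rw [h0]
    simpa using hbd h
  refine hO.trans_isLittleO ?_
  simpa using (Asymptotics.isLittleO_pow_id (𝕜 := ℝ) (n := 2) one_lt_two)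

theorem fbl_eq (β lam : ℝ) : fbl β lam =
    fun z => Ex ft (β * √(qOverlap β (β * lam * z))) (β * lam * z) := by
  funext z
  unfold fbl
  exact conv_ex ft _ _ _

theorem fbl_deriv {β lam z D : ℝ}
    (hD : HasDerivAt (fun h => Ex ft (β * √(qOverlap β h)) h) D (β * lam * z)) :
    HasDerivAt (fbl β lam) (D * (β * lam)) z := by
  rw [fbl_eq]
  have h1 : HasDerivAt (fun z => β * lam * z) (β * lam) z := by
    simpa using (hasDerivAt_id z).const_mul (β * lam)
  exact HasDerivAt.comp z hD h1

theorem fbl_deriv_zero {β lam : ℝ} (hβ : 0 < β) (hβ1 : β < 1) :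
    HasDerivAt (fbl β lam) (β * lam) 0 := by
  have := fbl_deriv (β := β) (lam := lam) (z := 0) (D := 1) (by
    rw [mul_zero]; exact T1_deriv_zero hβ hβ1)
  simpa using this

/-- Basic properties of `f_{β,λ}`: (i) at any `h > 0` where `(β, βλh)`
satisfies AT, `m ↦ f_{β,λ}(m)/m` has strictly negative derivative; (ii) at any `h` where
`(β, βλh)` satisfies AT, `f_{β,λ}` is differentiable with nonnegative derivative;
(iii) if `β < 1` then `f_{β,λ}` is differentiable at `0` with derivative `βλ`; in particular
`0` is a fixed point which is stable when `βλ < 1` and unstable when `βλ > 1`. -/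
theorem stmt15 (lam β : ℝ) (hlam : 1 < lam) (hβ : 0 < β) :
    (∀ h : ℝ, 0 < h → ATCond β (β * lam * h) →
      ∃ d : ℝ, d < 0 ∧ HasDerivAt (fun m => fbl β lam m / m) d h) ∧
    (∀ h : ℝ, ATCond β (β * lam * h) →
      ∃ d : ℝ, 0 ≤ d ∧ HasDerivAt (fbl β lam) d h) ∧
    (β < 1 →
      fbl β lam 0 = 0 ∧ HasDerivAt (fbl β lam) (β * lam) 0 ∧
      (β * lam < 1 → ∃ d : ℝ, HasDerivAt (fbl β lam) d 0 ∧ |d| < 1) ∧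
      (1 < β * lam → ∃ d : ℝ, HasDerivAt (fbl β lam) d 0 ∧ 1 < |d|)) := by
  have hbl : 0 < β * lam := mul_pos hβ (by linarith)
  refine ⟨fun h hh hAT => ?_, fun h hAT => ?_, fun hβ1 => ⟨?_, fbl_deriv_zero hβ hβ1,
    fun h1 => ⟨_, fbl_deriv_zero hβ hβ1, ?_⟩, fun h1 => ⟨_, fbl_deriv_zero hβ hβ1, ?_⟩⟩⟩
  · have hH : 0 < β * lam * h := mul_pos hbl hh
    obtain ⟨D, hD0, hD1, hD⟩ := main_deriv hβ hH.ne' hAT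
    obtain ⟨hm, -⟩ := q_spec (β := β) hH.ne'
    have hc := concave_ineq (mul_pos hβ (Real.sqrt_pos.2 hm.1)) hH
    have hf : fbl β lam h = Ex ft (β * √(qOverlap β (β * lam * h))) (β * lam * h) := by
      rw [fbl_eq]
    rw [← hf] at hc
    refine ⟨_, ?_, (fbl_deriv hD).div (hasDerivAt_id h) hh.ne'⟩
    refine div_neg_of_neg_of_pos ?_ (by positivity)
    have := mul_le_mul_of_nonneg_left hD1 hH.le
    linarith
  · rcases eq_or_ne h 0 with rfl | hh
    · have hβ1 : β < 1 := by
        unfold ATCond at hAT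
        rw [conv_ex (fun x => sech x ^ 4)] at hAT
        have : (fun x => sech x ^ 4) = fS4 := by funext x; exact sech_sq x
        rw [this, mul_zero] at hAT
        have : qOverlap β 0 = 0 := by simp [qOverlap]
        rw [this, Real.sqrt_zero, mul_zero, Ex_zero] at hAT
        simp only [fS4, Real.tanh_zero] at hAT
        nlinarith
      exact ⟨_, hbl.le, fbl_deriv_zero hβ hβ1⟩
    · obtain ⟨D, hD0, hD1, hD⟩ := main_deriv hβ (mul_ne_zero hbl.ne' hh) hAT
      exact ⟨_, mul_nonneg hD0 hbl.le, fbl_deriv hD⟩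
  · rw [fbl_eq]
    simp only [mul_zero]
    exact Ex_odd _
  · rwa [abs_of_pos hbl]
  · rwa [abs_of_pos hbl]
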